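/- arXiv:2510.15161 — 3 statements merged into one kernel-verified Lean document; each statement's English description precedes it below -/
import Mathlib

section
/- Let i ≥ 0 and let σ be a permutation of {0,1,…,i+1}. For 0 ≤ k ≤ i+1, let σ_k be the permutation of {0,1,…,i} defined by σ_k = δ_{σ(k)}^{−1} ∘ σ ∘ δ_k, where for j ∈ {0,…,i+1}, δ_j : {0,…,i} → {0,…,i+1} denotes the unique strictly increasing map whose image omits j. Then sign(σ_k) · (−1)^{σ(k)} · sign(σ) = (−1)^k; equivalently, sign(σ_k) = (−1)^{k+σ(k)} · sign(σ). -/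
/-- Deleting `k` from the domain and `σ k` from the codomain of `σ` leaves `τ`; moving both points
to `0` by cycles turns `σ` into the extension of `τ` fixing `0`. -/
theorem Equiv.Perm.mul_cycleRange_inv_eq {n : ℕ} (σ : Equiv.Perm (Fin (n + 1))) (k : Fin (n + 1))
    (τ : Equiv.Perm (Fin n)) (hτ : ∀ x : Fin n, (σ k).succAbove (τ x) = σ (k.succAbove x)) :
    σ * k.cycleRange⁻¹ = (σ k).cycleRange⁻¹ * Equiv.Perm.decomposeFin.symm (0, τ) := by
  ext x
  refine Fin.cases ?_ (fun x => ?_) x <;>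
    simp [Equiv.Perm.inv_def, Fin.cycleRange_symm_zero, Fin.cycleRange_symm_succ, hτ]

/-- For a permutation `σ` of `{0,…,i+1}` and `0 ≤ k ≤ i+1`, the induced permutation
`σ_k = δ_{σ(k)}⁻¹ ∘ σ ∘ δ_k` of `{0,…,i}` (where `δ_j` is the strictly increasing map
omitting `j` from its image, i.e. `Fin.succAbove j`) satisfies
`sign(σ_k)·(−1)^{σ(k)}·sign(σ) = (−1)^k`. -/
theorem stmt_6 (i : ℕ) (σ : Equiv.Perm (Fin (i + 2))) (k : Fin (i + 2))
    (τ : Equiv.Perm (Fin (i + 1)))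
    (hτ : ∀ x : Fin (i + 1), (σ k).succAbove (τ x) = σ (k.succAbove x)) :
    (Equiv.Perm.sign τ : ℤ) * (-1) ^ ((σ k : ℕ)) * (Equiv.Perm.sign σ : ℤ) =
      (-1) ^ (k : ℕ) := by
  have h := congrArg (fun ρ => (Equiv.Perm.sign ρ : ℤ))
    (Equiv.Perm.mul_cycleRange_inv_eq σ k τ hτ)
  simp only [Equiv.Perm.sign_mul, Equiv.Perm.sign_inv, Fin.sign_cycleRange,
    Equiv.Perm.decomposeFin.symm_sign, if_true, one_mul, Units.val_mul, Units.val_pow_eq_pow_val,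
    Units.val_neg, Units.val_one] at h
  have hσ : (Equiv.Perm.sign σ : ℤ) * (Equiv.Perm.sign σ : ℤ) = 1 :=
    Int.units_coe_mul_self _
  linear_combination (-(Equiv.Perm.sign σ : ℤ)) * h + (-1) ^ (k : ℕ) * hσ
end

section
/- Let v_1,…,v_i be nonzero vectors in 𝔽_q^n whose heights are pairwise distinct. Then there exists an invertible upper-triangular matrix h ∈ GL_n(𝔽_q) such that h v_j = e_{height(v_j)} for every 1 ≤ j ≤ i. -/
/-- If the `k`-th column has height `k` for every `k`, some invertible upper-triangular matrix
sends each column to the corresponding standard basis vector. -/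
theorem exists_upperTriangular_mulVec_eq_single {n : Type*} [Fintype n] [LinearOrder n]
    {F : Type*} [Field F] (w : n → n → F)
    (hw : ∀ k, w k k ≠ 0 ∧ ∀ l, k < l → w k l = 0) :
    ∃ h : Matrix n n F, IsUnit h ∧ h.BlockTriangular id ∧
      ∀ k, h.mulVec (w k) = Pi.single k 1 := by
  let M : Matrix n n F := Matrix.of fun a k => w k a
  have hM : M.BlockTriangular id := fun a k hk => (hw k).2 a hk
  have hdet : IsUnit M.det := by
    rw [Matrix.det_of_isUpperTriangular hM, isUnit_iff_ne_zero, Finset.prod_ne_zero_iff]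
    exact fun k _ => (hw k).1
  let _ := M.invertibleOfIsUnitDet hdet
  refine ⟨M⁻¹, Matrix.isUnit_nonsing_inv_iff.mpr ((Matrix.isUnit_iff_isUnit_det M).mpr hdet),
    Matrix.blockTriangular_inv_of_blockTriangular hM, fun k => ?_⟩
  have hcol : w k = M.mulVec (Pi.single k 1) := by
    ext a
    simp [M]
  rw [hcol, Matrix.mulVec_mulVec, Matrix.nonsing_inv_mul M hdet, Matrix.one_mulVec]

/-- **Sorting vectors of distinct heights by an upper-triangular matrix.** Let `v_1,…,v_i` be
vectors in `𝔽_q^n` with pairwise distinct heights (the height of `v` being the largest index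
whose coordinate is nonzero; here `ht j` records the height of `v j`). Then there is an
invertible upper-triangular matrix `h` with `h v_j = e_{height(v_j)}` for every `j`. -/
theorem stmt_12 (q n i : ℕ) (hq : IsPrimePow q) (hn : 1 ≤ n)
    (F : Type) [Field F] [Fintype F] (hF : Fintype.card F = q)
    (v : Fin i → (Fin n → F)) (ht : Fin i → Fin n)
    (hheight : ∀ j, v j (ht j) ≠ 0 ∧ ∀ j' : Fin n, ht j < j' → v j j' = 0)
    (hdistinct : Function.Injective ht) :
    ∃ h : Matrix (Fin n) (Fin n) F, IsUnit h ∧ h.BlockTriangular id ∧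
      ∀ j, h.mulVec (v j) = Pi.single (ht j) 1 := by
  obtain ⟨h, hunit, htri, hh⟩ := exists_upperTriangular_mulVec_eq_single
    (Function.extend ht v fun k => Pi.single k 1) fun k => by
      by_cases hk : ∃ j, ht j = k
      · obtain ⟨j, rfl⟩ := hk
        rw [hdistinct.extend_apply]
        exact hheight j
      · rw [Function.extend_apply' _ _ _ hk]
        exact ⟨by simp, fun l hl => Pi.single_eq_of_ne hl.ne' 1⟩
  refine ⟨h, hunit, htri, fun j => ?_⟩
  rw [← hh (ht j), hdistinct.extend_apply]
end

section
/- Two flags W_0 ⊊ W_1 ⊊ … ⊊ W_i and W'_0 ⊊ W'_1 ⊊ … ⊊ W'_i of nontrivial proper linear subspaces of 𝔽_q^n lie in the same orbit of H (acting componentwise on flags) if and only if profile(W_j) = profile(W'_j) for every 0 ≤ j ≤ i. Moreover, the height-profile map induces a bijection between the set of H-orbits of such i-flags of subspaces and the set of flags ∅ ≠ V_0 ⊊ V_1 ⊊ … ⊊ V_i ⊊ [n] of subsets of [n] = {1,…,n}. -/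
/-- The height profile of a subspace `W ⊆ 𝔽_q^n`: the set of indices `j` arising as the height
(largest index with nonzero coordinate) of some nonzero vector of `W`. -/
def heightProfile {F : Type} [Field F] {n : ℕ} (W : Submodule F (Fin n → F)) : Set (Fin n) :=
  { j : Fin n | ∃ v ∈ W, v j ≠ 0 ∧ ∀ j' : Fin n, j < j' → v j' = 0 }

section HeightProfile

open Matrix

variable {F : Type} [Field F] {n : ℕ}

lemma heightProfile_mono {V W : Submodule F (Fin n → F)} (h : V ≤ W) :
    heightProfile V ⊆ heightProfile W := by
  rintro j ⟨v, hv, hj⟩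
  exact ⟨v, h hv, hj⟩

/-- A subspace contains every larger subspace that has no new heights. -/
lemma le_of_heightProfile_subset {V W : Submodule F (Fin n → F)} (h : V ≤ W)
    (hp : heightProfile W ⊆ heightProfile V) : W ≤ V := by
  have key : ∀ m : ℕ, ∀ w ∈ W, (∀ k : Fin n, m ≤ k → w k = 0) → w ∈ V := by
    intro m
    induction m with
    | zero =>
      intro w _ h0
      have : w = 0 := funext fun k => h0 k (Nat.zero_le _)
      exact this ▸ V.zero_mem
    | succ m ih =>
      intro w hw hm
      by_cases hwm : ∀ k : Fin n, (k : ℕ) = m → w k = 0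
      · refine ih w hw fun k hk => ?_
        rcases hk.eq_or_lt with hk | hk
        · exact hwm k hk.symm
        · exact hm k hk
      · push Not at hwm
        obtain ⟨k, hkm, hk⟩ := hwm
        obtain ⟨v, hv, hvk, hv0⟩ := hp ⟨w, hw, hk, fun l hl => hm l (by
          have : (k : ℕ) < l := hl
          omega)⟩
        have hsub : w - (w k / v k) • v ∈ V := by
          refine ih _ (W.sub_mem hw (W.smul_mem _ (h hv))) fun l hl => ?_
          rcases eq_or_ne l k with rfl | hlk
          · simp [hvk]
          · have hkl : k < l := by
              have : (l : ℕ) ≠ k := fun h => hlk (Fin.ext h)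
              exact Fin.lt_def.2 (by omega)
            have hl' : m + 1 ≤ (l : ℕ) := by
              have : (k : ℕ) < l := hkl
              omega
            simp [hm l hl', hv0 l hkl]
        simpa using V.add_mem hsub (V.smul_mem (w k / v k) hv)
  exact fun w hw => key n w hw fun k hk => absurd k.isLt (by omega)

lemma eq_of_le_of_heightProfile_eq {V W : Submodule F (Fin n → F)} (h : V ≤ W)
    (hp : heightProfile V = heightProfile W) : V = W :=
  le_antisymm h (le_of_heightProfile_subset h hp.ge)

lemma heightProfile_strictMono :
    StrictMono (heightProfile : Submodule F (Fin n → F) → Set (Fin n)) := fun _ _ h =>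
  (heightProfile_mono h.le).lt_of_ne fun hp => h.ne (eq_of_le_of_heightProfile_eq h.le hp)

lemma heightProfile_pi (U : Set (Fin n)) :
    heightProfile (Submodule.pi Uᶜ fun _ => (⊥ : Submodule F F)) = U := by
  ext k
  constructor
  · rintro ⟨v, hv, hk, -⟩
    by_contra hkU
    exact hk (by simpa using hv k hkU)
  · intro hk
    refine ⟨Pi.single k 1, fun l hl => ?_, by simp, fun l hl => by simp [hl.ne']⟩
    have : l ≠ k := fun h => hl (h ▸ hk)
    simp [this]

lemma heightProfile_bot : heightProfile (⊥ : Submodule F (Fin n → F)) = ∅ := by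
  ext k
  simp [heightProfile]

lemma heightProfile_top : heightProfile (⊤ : Submodule F (Fin n → F)) = Set.univ :=
  Set.eq_univ_of_univ_subset <|
    (heightProfile_pi (F := F) Set.univ).ge.trans (heightProfile_mono le_top)

lemma heightProfile_eq_empty {W : Submodule F (Fin n → F)} : heightProfile W = ∅ ↔ W = ⊥ :=
  ⟨fun h => (eq_of_le_of_heightProfile_eq bot_le (heightProfile_bot.trans h.symm)).symm,
    fun h => h ▸ heightProfile_bot⟩

lemma heightProfile_eq_univ {W : Submodule F (Fin n → F)} :
    heightProfile W = Set.univ ↔ W = ⊤ :=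
  ⟨fun h => eq_of_le_of_heightProfile_eq le_top (h.trans heightProfile_top.symm),
    fun h => h ▸ heightProfile_top⟩

lemma isUnit_iff_diag_ne_zero {h : Matrix (Fin n) (Fin n) F} (ht : h.BlockTriangular id) :
    IsUnit h ↔ ∀ k, h k k ≠ 0 := by
  rw [Matrix.isUnit_iff_isUnit_det, Matrix.det_of_isUpperTriangular ht, isUnit_iff_ne_zero,
    Finset.prod_ne_zero_iff]
  simp

lemma blockTriangular_inv {h : Matrix (Fin n) (Fin n) F} (hu : IsUnit h)
    (ht : h.BlockTriangular id) : h⁻¹.BlockTriangular id := by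
  have := hu.invertible
  exact Matrix.blockTriangular_inv_of_blockTriangular ht

lemma map_mulVecLin_inv_map {h : Matrix (Fin n) (Fin n) F} (hu : IsUnit h)
    (W : Submodule F (Fin n → F)) : (W.map h.mulVecLin).map h⁻¹.mulVecLin = W := by
  rw [← Submodule.map_comp, ← Matrix.mulVecLin_mul,
    Matrix.nonsing_inv_mul _ ((Matrix.isUnit_iff_isUnit_det _).1 hu), Matrix.mulVecLin_one,
    Submodule.map_id]

lemma heightProfile_subset_map {h : Matrix (Fin n) (Fin n) F} (hu : IsUnit h)
    (ht : h.BlockTriangular id) (W : Submodule F (Fin n → F)) :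
    heightProfile W ⊆ heightProfile (W.map h.mulVecLin) := by
  rintro k ⟨v, hv, hk, hv0⟩
  refine ⟨h *ᵥ v, ⟨v, hv, rfl⟩, ?_, fun l hl => ?_⟩
  · have : (h *ᵥ v) k = h k k * v k := by
      refine Finset.sum_eq_single k (fun m _ hm => ?_) fun hk => absurd (Finset.mem_univ k) hk
      rcases hm.lt_or_gt with hm | hm
      · simp [ht (show id m < id k from hm)]
      · simp [hv0 m hm]
    rw [this]
    exact mul_ne_zero ((isUnit_iff_diag_ne_zero ht).1 hu k) hk
  · change ∑ m, h l m * v m = 0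
    refine Finset.sum_eq_zero fun m _ => ?_
    rcases le_or_gt m k with hm | hm
    · simp [ht (show id m < id l from hm.trans_lt hl)]
    · simp [hv0 m hm]

lemma heightProfile_map {h : Matrix (Fin n) (Fin n) F} (hu : IsUnit h)
    (ht : h.BlockTriangular id) (W : Submodule F (Fin n → F)) :
    heightProfile (W.map h.mulVecLin) = heightProfile W := by
  refine (heightProfile_subset_map hu ht W).antisymm' ?_
  have := heightProfile_subset_map (Matrix.isUnit_nonsing_inv_iff.2 hu)
    (blockTriangular_inv hu ht) (W.map h.mulVecLin)
  rwa [map_mulVecLin_inv_map hu] at this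

/-- Every chain of subspaces is the image of a chain of coordinate subspaces under an invertible
upper-triangular matrix. -/
lemma exists_blockTriangular_map_pi {ι : Type*} [LinearOrder ι] [WellFoundedLT ι]
    {W : ι → Submodule F (Fin n → F)} (hW : Monotone W) :
    ∃ h : Matrix (Fin n) (Fin n) F, IsUnit h ∧ h.BlockTriangular id ∧
      ∀ j, (Submodule.pi (heightProfile (W j))ᶜ fun _ => (⊥ : Submodule F F)).map h.mulVecLin
        = W j := by
  have hb : ∀ k : Fin n, ∃ b : Fin n → F, (b k ≠ 0 ∧ ∀ l, k < l → b l = 0) ∧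
      ∀ j, k ∈ heightProfile (W j) → b ∈ W j := by
    intro k
    by_cases hk : ∃ j, k ∈ heightProfile (W j)
    · obtain ⟨j, ⟨b, hb, hbk⟩, hmin⟩ := WellFounded.has_min (wellFounded_lt (α := ι)) _ hk
      exact ⟨b, hbk, fun j' hj' => hW (not_lt.1 (hmin j' hj')) hb⟩
    · exact ⟨Pi.single k 1, ⟨by simp, fun l hl => by simp [hl.ne']⟩, fun j hj => (hk ⟨j, hj⟩).elim⟩
  choose b hb hbW using hb
  have ht : (Matrix.of fun l k => b k l).BlockTriangular id := fun l k hlk => (hb k).2 l hlk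
  have hu := (isUnit_iff_diag_ne_zero ht).2 fun k => (hb k).1
  refine ⟨_, hu, ht, fun j => eq_of_le_of_heightProfile_eq ?_ ?_⟩
  · rintro _ ⟨v, hv, rfl⟩
    have : (Matrix.of fun l k => b k l).mulVecLin v = ∑ k, v k • b k := by
      ext l
      simp [Matrix.mulVec, dotProduct, mul_comm]
    rw [this]
    refine Submodule.sum_mem _ fun k _ => ?_
    by_cases hk : k ∈ heightProfile (W j)
    · exact Submodule.smul_mem _ _ (hbW k j hk)
    · have : v k = 0 := by simpa using hv k hk
      simp [this]
  · rw [heightProfile_map hu ht, heightProfile_pi]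

lemma exists_blockTriangular_map_eq_iff {ι : Type*} [LinearOrder ι] [WellFoundedLT ι]
    {W W' : ι → Submodule F (Fin n → F)} (hW : Monotone W) (hW' : Monotone W') :
    (∃ h : Matrix (Fin n) (Fin n) F, IsUnit h ∧ h.BlockTriangular id ∧
      ∀ j, (W j).map h.mulVecLin = W' j) ↔
    ∀ j, heightProfile (W j) = heightProfile (W' j) := by
  constructor
  · rintro ⟨h, hu, ht, hmap⟩ j
    rw [← hmap j, heightProfile_map hu ht]
  · intro hp
    obtain ⟨g, hgu, hgt, hg⟩ := exists_blockTriangular_map_pi hW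
    obtain ⟨g', hgu', hgt', hg'⟩ := exists_blockTriangular_map_pi hW'
    refine ⟨g' * g⁻¹, hgu'.mul (Matrix.isUnit_nonsing_inv_iff.2 hgu),
      hgt'.mul (blockTriangular_inv hgu hgt), fun j => ?_⟩
    rw [Matrix.mulVecLin_mul, Submodule.map_comp, ← hg j, map_mulVecLin_inv_map hgu, hp j, hg' j]

end HeightProfile


/-- **H-orbits of flags are indexed by height profiles.** Two flags of nontrivial proper
subspaces of `𝔽_q^n` lie in the same orbit of the upper-triangular group `H` iff their
members have the same height profiles; moreover the height-profile map induces a bijection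
between `H`-orbits of `i`-flags of subspaces and flags `∅ ≠ V_0 ⊊ V_1 ⊊ … ⊊ V_i ⊊ [n]` of
subsets of `[n]`. -/
theorem stmt_13 (q n i : ℕ) (hq : IsPrimePow q) (hn : 2 ≤ n)
    (F : Type) [Field F] [Fintype F] (hF : Fintype.card F = q) :
    (∀ W W' : Fin (i + 1) → Submodule F (Fin n → F),
      (StrictMono W ∧ ∀ j, W j ≠ ⊥ ∧ W j ≠ ⊤) →
      (StrictMono W' ∧ ∀ j, W' j ≠ ⊥ ∧ W' j ≠ ⊤) →
      ((∃ h : Matrix (Fin n) (Fin n) F, IsUnit h ∧ h.BlockTriangular id ∧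
          ∀ j, (W j).map h.mulVecLin = W' j) ↔
        ∀ j, heightProfile (W j) = heightProfile (W' j)))
    ∧ (∀ W : Fin (i + 1) → Submodule F (Fin n → F),
        (StrictMono W ∧ ∀ j, W j ≠ ⊥ ∧ W j ≠ ⊤) →
        (StrictMono (fun j => heightProfile (W j)) ∧
          heightProfile (W 0) ≠ ∅ ∧ heightProfile (W (Fin.last i)) ≠ Set.univ))
    ∧ (∀ U : Fin (i + 1) → Set (Fin n),
        StrictMono U → U 0 ≠ ∅ → U (Fin.last i) ≠ Set.univ →
        ∃ W : Fin (i + 1) → Submodule F (Fin n → F),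
          (StrictMono W ∧ ∀ j, W j ≠ ⊥ ∧ W j ≠ ⊤) ∧
          ∀ j, heightProfile (W j) = U j) := by
  refine ⟨fun W W' hW hW' => exists_blockTriangular_map_eq_iff hW.1.monotone hW'.1.monotone,
    fun W hW => ⟨heightProfile_strictMono.comp hW.1, ?_, ?_⟩, fun U hU hU0 hUi => ?_⟩
  · exact fun h => (hW.2 0).1 (heightProfile_eq_empty.1 h)
  · exact fun h => (hW.2 (Fin.last i)).2 (heightProfile_eq_univ.1 h)
  · refine ⟨fun j => Submodule.pi (U j)ᶜ fun _ => ⊥, ⟨?_, fun j => ⟨?_, ?_⟩⟩,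
      fun j => heightProfile_pi (U j)⟩
    · refine Monotone.strictMono_of_injective (fun j k hjk v hv l hl => ?_) fun j k hjk => ?_
      · exact hv l fun h => hl (hU.monotone hjk h)
      · refine hU.injective ?_
        rw [← heightProfile_pi (F := F) (U j), ← heightProfile_pi (F := F) (U k)]
        exact congrArg heightProfile hjk
    · rw [Ne, ← heightProfile_eq_empty, heightProfile_pi]
      exact fun h => hU0 (Set.subset_eq_empty (hU.monotone (Fin.zero_le j)) h)
    · rw [Ne, ← heightProfile_eq_univ, heightProfile_pi]
      exact fun h => hUi (Set.eq_univ_of_univ_subset (h.ge.trans (hU.monotone (Fin.le_last j))))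
end
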